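/- arXiv:2605.29781 — 3 statements merged into one kernel-verified Lean document; each statement's English description precedes it below -/
import Mathlib

section
/- For every λ ∈ ℤ∖{0}, every ℓ ∈ ℕ and every (a,b,c) ∈ ℝ³, the matrix coefficient of the Schrödinger representation against the rescaled Hermite function is a Laguerre function: ∫_ℝ h_{ℓ,λ}(u) · conj(e^{2πiλ(c+ub)} h_{ℓ,λ}(u+a)) du = e^{−2πiλc} · e^{πiλba} · 𝓛_ℓ(π|λ|(a²+b²)). -/
open MeasureTheory Real Complex
open scoped ComplexConjugate

/-- Physicists' Hermite polynomial `H_ℓ(u) = (-1)^ℓ e^{u²} (d/du)^ℓ e^{-u²}`. -/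
noncomputable def hermitePoly (ℓ : ℕ) (u : ℝ) : ℝ :=
  (-1 : ℝ) ^ ℓ * Real.exp (u ^ 2) * iteratedDeriv ℓ (fun t : ℝ => Real.exp (-t ^ 2)) u

/-- Normalised Hermite function `h_ℓ(u) = (√π 2^ℓ ℓ!)^{-1/2} H_ℓ(u) e^{-u²/2}`. -/
noncomputable def hermiteFun (ℓ : ℕ) (u : ℝ) : ℝ :=
  (Real.sqrt π * 2 ^ ℓ * (ℓ.factorial : ℝ)) ^ (-(1 : ℝ) / 2) *
    hermitePoly ℓ u * Real.exp (-u ^ 2 / 2)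

/-- Rescaled Hermite function `h_{ℓ,λ}(u) = (2π|λ|)^{1/4} h_ℓ(√(2π|λ|) u)`. -/
noncomputable def hermiteScaled (ℓ : ℕ) (lam : ℤ) (u : ℝ) : ℝ :=
  (2 * π * |(lam : ℝ)|) ^ ((1 : ℝ) / 4) * hermiteFun ℓ (Real.sqrt (2 * π * |(lam : ℝ)|) * u)

/-- Laguerre polynomial of type 0 and degree ℓ. -/
noncomputable def laguerrePoly (ℓ : ℕ) (v : ℝ) : ℝ :=
  ∑ k ∈ Finset.range (ℓ + 1), (-1 : ℝ) ^ k * (ℓ.choose (ℓ - k) : ℝ) * v ^ k / (k.factorial : ℝ)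

/-- Laguerre function `𝓛_ℓ(v) = L_ℓ(v) e^{-v/2}`. -/
noncomputable def laguerreFun (ℓ : ℕ) (v : ℝ) : ℝ := laguerrePoly ℓ v * Real.exp (-v / 2)

open Polynomial in
/-- Physicists' Hermite polynomials as polynomials over a commutative ring. -/
noncomputable def physHermite (R : Type*) [CommRing R] : ℕ → R[X]
  | 0 => 1
  | n + 1 => 2 * X * physHermite R n - derivative (physHermite R n)

section Algebra

open Polynomial

theorem physHermite_zero (R : Type*) [CommRing R] : physHermite R 0 = 1 := rfl

theorem physHermite_succ (R : Type*) [CommRing R] (n : ℕ) :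
    physHermite R (n + 1) = 2 * X * physHermite R n - derivative (physHermite R n) := rfl

theorem map_physHermite {R S : Type*} [CommRing R] [CommRing S] (f : R →+* S) (n : ℕ) :
    (physHermite R n).map f = physHermite S n := by
  induction n with
  | zero => simp [physHermite_zero]
  | succ n ih => simp [physHermite_succ, ih, ← derivative_map]

theorem derivative_physHermite_succ (R : Type*) [CommRing R] (n : ℕ) :
    derivative (physHermite R (n + 1)) = C (2 * (n + 1 : R)) * physHermite R n := by
  induction n with
  | zero => simp [physHermite_succ, physHermite_zero, map_ofNat C 2]
  | succ n ih =>
    rw [physHermite_succ R (n + 1), derivative_sub, derivative_mul, ih, derivative_C_mul,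
      physHermite_succ R n]
    simp [map_ofNat C 2]
    ring

variable {R : Type*} [CommRing R]

theorem physHermite_comp_X_add_C_succ (z : R) (n : ℕ) :
    (physHermite R (n + 1)).comp (X + C z) =
      2 * (X + C z) * (physHermite R n).comp (X + C z) -
        derivative ((physHermite R n).comp (X + C z)) := by
  simp [physHermite_succ, derivative_comp]

theorem iterate_derivative_physHermite_comp (z : R) {n k : ℕ} (hk : k ≤ n) :
    derivative^[k] ((physHermite R n).comp (X + C z)) =
      C (2 ^ k * (n.descFactorial k : R)) * (physHermite R (n - k)).comp (X + C z) := by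
  induction k with
  | zero => simp
  | succ k ih =>
    obtain ⟨m, hm⟩ : ∃ m, n - k = m + 1 := ⟨n - k - 1, by omega⟩
    have hm' : n - (k + 1) = m := by omega
    rw [Function.iterate_succ_apply', ih (by omega), derivative_C_mul, hm, derivative_comp,
      derivative_physHermite_succ, hm', Nat.descFactorial_succ, hm]
    simp
    ring

/-- A linear functional obeying the integration by parts rule of a Gaussian weight turns
multiplication by a translated Hermite polynomial into a power of a differential operator. -/
theorem apply_physHermite_comp_mul (L : R[X] →ₗ[R] R) (d : R)
    (hL : ∀ P, L (derivative P) = L ((2 * X + C d) * P)) (z : R) (n : ℕ) (Q : R[X]) :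
    L ((physHermite R n).comp (X + C z) * Q) =
      L ((((derivative : Module.End R R[X]) + algebraMap R (Module.End R R[X]) (2 * z - d)) ^ n) Q) := by
  induction n generalizing Q with
  | zero => simp [physHermite_zero]
  | succ n ih =>
    rw [pow_succ, Module.End.mul_apply, ← ih, physHermite_comp_X_add_C_succ]
    set K := (physHermite R n).comp (X + C z)
    have h := hL (K * Q)
    rw [derivative_mul, map_add] at h
    have h1 : (2 * (X + C z) * K - derivative K) * Q
        = (2 * X + C d) * (K * Q) + C (2 * z - d) * (K * Q) - derivative K * Q := by
      simp [map_ofNat C 2]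
      ring
    have h2 : K * (((derivative : Module.End R R[X]) + algebraMap R (Module.End R R[X]) (2 * z - d)) Q)
        = K * derivative Q + C (2 * z - d) * (K * Q) := by
      simp [Module.algebraMap_end_apply, smul_eq_C_mul]
      ring
    rw [h1, h2, map_sub, map_add, map_add, ← h]
    ring

theorem apply_physHermite_comp (L : R[X] →ₗ[R] R) (d : R)
    (hL : ∀ P, L (derivative P) = L ((2 * X + C d) * P)) (z : R) (n : ℕ) :
    L ((physHermite R n).comp (X + C z)) = (2 * z - d) ^ n * L 1 := by
  have key : ∀ m : ℕ, (((derivative : Module.End R R[X]) + algebraMap R (Module.End R R[X]) (2 * z - d)) ^ m) (1 : R[X])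
      = (2 * z - d) ^ m • (1 : R[X]) := by
    intro m
    induction m with
    | zero => simp
    | succ m ih =>
      rw [pow_succ', Module.End.mul_apply, ih, LinearMap.map_smul, LinearMap.add_apply,
        derivative_one, Module.algebraMap_end_apply, zero_add, smul_smul, pow_succ]
  have h := apply_physHermite_comp_mul L d hL z n 1
  rw [mul_one, key, map_smul, smul_eq_mul] at h
  exact h

theorem apply_physHermite_comp_mul_physHermite_comp (L : R[X] →ₗ[R] R) (d : R)
    (hL : ∀ P, L (derivative P) = L ((2 * X + C d) * P)) (z w : R) (n : ℕ) :
    L ((physHermite R n).comp (X + C z) * (physHermite R n).comp (X + C w)) =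
      ∑ k ∈ Finset.range (n + 1), 2 ^ k * (n.descFactorial k : R) * (n.choose k : R) *
        ((2 * z - d) * (2 * w - d)) ^ (n - k) * L 1 := by
  rw [apply_physHermite_comp_mul L d hL,
    (Algebra.commute_algebraMap_right (2 * z - d) (derivative : Module.End R R[X])).add_pow,
    LinearMap.sum_apply, map_sum]
  refine Finset.sum_congr rfl fun k hk => ?_
  have hk' : k ≤ n := by simpa [Nat.lt_succ_iff] using hk
  have hcast : ((n.choose k : ℕ) : Module.End R R[X]) =
      algebraMap R (Module.End R R[X]) (n.choose k : R) := by simp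
  rw [← map_pow, hcast, mul_assoc, ← map_mul, Module.End.mul_apply, Module.algebraMap_end_apply,
    map_smul, map_smul, Module.End.pow_apply, iterate_derivative_physHermite_comp w hk',
    ← smul_eq_C_mul, map_smul, apply_physHermite_comp L d hL, smul_eq_mul, smul_eq_mul, mul_pow]
  ring

end Algebra

theorem iteratedDeriv_exp_neg_sq (n : ℕ) :
    iteratedDeriv n (fun t : ℝ => Real.exp (-t ^ 2)) =
      fun u => (-1) ^ n * (physHermite ℝ n).eval u * Real.exp (-u ^ 2) := by
  induction n with
  | zero => simp [physHermite_zero]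
  | succ n ih =>
    rw [iteratedDeriv_succ, ih]
    funext u
    have h1 : HasDerivAt (fun t : ℝ => Real.exp (-t ^ 2)) (Real.exp (-u ^ 2) * (-(2 * u))) u := by
      simpa using ((hasDerivAt_pow 2 u).neg).exp
    refine ((((physHermite ℝ n).hasDerivAt u).const_mul ((-1) ^ n)).mul h1).deriv.trans ?_
    simp [physHermite_succ]
    ring

theorem hermitePoly_eq_eval (n : ℕ) (u : ℝ) : hermitePoly n u = (physHermite ℝ n).eval u := by
  simp only [hermitePoly, iteratedDeriv_exp_neg_sq]
  rw [Real.exp_neg]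
  have h1 : ((-1 : ℝ) ^ n) * (-1) ^ n = 1 := by rw [← mul_pow]; simp
  have h2 : Real.exp (u ^ 2) * (Real.exp (u ^ 2))⁻¹ = 1 :=
    mul_inv_cancel₀ (Real.exp_pos _).ne'
  linear_combination (physHermite ℝ n).eval u * (h1 * (Real.exp (u ^ 2) * (Real.exp (u ^ 2))⁻¹) + h2)

/-- The product of two Gaussians, one translated by `x`, and of the character of frequency `y`. -/
noncomputable def gaussWeight (x y : ℝ) (t : ℝ) : ℂ :=
  Complex.exp (-(t : ℂ) ^ 2 - (x + y * I) * t - x ^ 2 / 2)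

theorem continuous_gaussWeight (x y : ℝ) : Continuous (gaussWeight x y) := by
  unfold gaussWeight
  fun_prop

theorem norm_gaussWeight_le (x y t : ℝ) : ‖gaussWeight x y t‖ ≤ Real.exp (-(1 / 2) * t ^ 2) := by
  rw [gaussWeight, Complex.norm_exp, Real.exp_le_exp]
  have : (-(t : ℂ) ^ 2 - (x + y * I) * t - x ^ 2 / 2) =
      ((-t ^ 2 - x * t - x ^ 2 / 2 : ℝ) : ℂ) + ((-(y * t) : ℝ) : ℂ) * I := by
    push_cast
    ring
  rw [this, ← Complex.mk_eq_add_mul_I]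
  nlinarith [sq_nonneg (t + x)]

theorem integrable_eval_mul_gaussWeight (x y : ℝ) (P : Polynomial ℂ) :
    Integrable fun t : ℝ => P.eval (t : ℂ) * gaussWeight x y t := by
  have hmono : ∀ k : ℕ, Integrable fun t : ℝ => (t : ℂ) ^ k * gaussWeight x y t := by
    intro k
    have h := integrable_rpow_mul_exp_neg_mul_sq (b := 1 / 2) (by norm_num) (s := k)
      (by have := Nat.cast_nonneg (α := ℝ) k; linarith)
    simp only [Real.rpow_natCast] at h
    refine h.mono ?_ (Filter.Eventually.of_forall fun t => ?_)
    · exact (Continuous.mul (by fun_prop) (continuous_gaussWeight x y)).aestronglyMeasurable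
    · rw [norm_mul, norm_mul, norm_pow, norm_pow, Complex.norm_real,
        Real.norm_of_nonneg (Real.exp_pos _).le]
      gcongr
      exact norm_gaussWeight_le x y t
  simp_rw [Polynomial.eval_eq_sum_range, Finset.sum_mul, mul_assoc]
  exact integrable_finsetSum _ fun k _ => (hmono k).const_mul _

/-- Integration of complex polynomials against `gaussWeight x y`. -/
noncomputable def gaussFunctional (x y : ℝ) : Polynomial ℂ →ₗ[ℂ] ℂ where
  toFun P := ∫ t : ℝ, P.eval (t : ℂ) * gaussWeight x y t
  map_add' P Q := by
    simp_rw [Polynomial.eval_add, add_mul]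
    exact integral_add (integrable_eval_mul_gaussWeight x y P)
      (integrable_eval_mul_gaussWeight x y Q)
  map_smul' r P := by
    simp_rw [Polynomial.eval_smul, smul_eq_mul, mul_assoc]
    exact integral_const_mul r _

theorem gaussFunctional_apply (x y : ℝ) (P : Polynomial ℂ) :
    gaussFunctional x y P = ∫ t : ℝ, P.eval (t : ℂ) * gaussWeight x y t := rfl

theorem hasDerivAt_gaussWeight (x y t : ℝ) :
    HasDerivAt (gaussWeight x y) (-(2 * t + (x + y * I)) * gaussWeight x y t) t := by
  have h : HasDerivAt (fun z : ℂ => Complex.exp (-z ^ 2 - (x + y * I) * z - x ^ 2 / 2))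
      (Complex.exp (-(t : ℂ) ^ 2 - (x + y * I) * t - x ^ 2 / 2) *
        (-(2 * (t : ℂ)) - (x + y * I))) (t : ℂ) := by
    refine HasDerivAt.cexp ?_
    simpa using (((hasDerivAt_pow 2 (t : ℂ)).neg.sub
      ((hasDerivAt_id (t : ℂ)).const_mul (x + y * I : ℂ))).sub_const ((x : ℂ) ^ 2 / 2))
  refine h.comp_ofReal.congr_deriv ?_
  rw [gaussWeight]
  ring

theorem gaussFunctional_derivative (x y : ℝ) (P : Polynomial ℂ) :
    gaussFunctional x y (Polynomial.derivative P) =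
      gaussFunctional x y ((2 * Polynomial.X + Polynomial.C (x + y * I : ℂ)) * P) := by
  rw [← sub_eq_zero, ← map_sub, gaussFunctional_apply]
  refine integral_eq_zero_of_hasDerivAt_of_integrable
    (f := fun t : ℝ => P.eval (t : ℂ) * gaussWeight x y t) (fun t => ?_)
    (integrable_eval_mul_gaussWeight x y _) (integrable_eval_mul_gaussWeight x y P)
  refine ((P.hasDerivAt (t : ℂ)).comp_ofReal.mul (hasDerivAt_gaussWeight x y t)).congr_deriv ?_
  simp
  ring

theorem gaussFunctional_one (x y : ℝ) :
    gaussFunctional x y 1 =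
      (Real.sqrt π : ℂ) * Complex.exp (x * y * I / 2) * Complex.exp (-(x ^ 2 + y ^ 2) / 4) := by
  have h := integral_cexp_quadratic (b := -1) (by simp) (-(x + y * I)) (-(x ^ 2 / 2) : ℂ)
  have h' : gaussFunctional x y 1 =
      ∫ t : ℝ, Complex.exp (-1 * (t : ℂ) ^ 2 + -(x + y * I) * t + -(x ^ 2 / 2)) := by
    simp only [gaussFunctional_apply, Polynomial.eval_one, one_mul, gaussWeight]
    congr 1
    funext t
    congr 1
    ring
  rw [h', h, mul_assoc, ← Complex.exp_add]
  congr 1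
  · rw [neg_neg, div_one, Real.sqrt_eq_rpow, Complex.ofReal_cpow pi_pos.le]
    norm_num
  · congr 1
    linear_combination (-(y : ℂ) ^ 2 / 4) * (-I_sq)

theorem sum_descFactorial_eq_laguerrePoly (n : ℕ) (v : ℝ) :
    ∑ k ∈ Finset.range (n + 1), 2 ^ k * (n.descFactorial k : ℝ) * (n.choose k : ℝ) *
      (-(2 * v)) ^ (n - k) = 2 ^ n * (n.factorial : ℝ) * laguerrePoly n v := by
  rw [← Finset.sum_range_reflect, laguerrePoly, Finset.mul_sum]
  refine Finset.sum_congr rfl fun k hk => ?_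
  have hk' : k ≤ n := by simpa [Nat.lt_succ_iff] using hk
  have e1 : n + 1 - 1 - k = n - k := by omega
  have e2 : n - (n - k) = k := by omega
  have hf : (k.factorial : ℝ) * (n.descFactorial (n - k) : ℝ) = n.factorial := by
    have := Nat.factorial_mul_descFactorial (Nat.sub_le n k)
    rw [e2] at this
    exact_mod_cast this
  have h2 : (2 : ℝ) ^ n = 2 ^ (n - k) * 2 ^ k := by rw [← pow_add]; congr 1; omega
  have hk0 : (k.factorial : ℝ) ≠ 0 := by positivity
  rw [e1, e2, ← hf, h2, neg_pow, mul_pow]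
  field_simp

theorem gaussFunctional_physHermite (x y : ℝ) (n : ℕ) :
    gaussFunctional x y (physHermite ℂ n * (physHermite ℂ n).comp (.X + .C (x : ℂ))) =
      ((Real.sqrt π * 2 ^ n * n.factorial : ℝ) : ℂ) * Complex.exp (x * y * I / 2) *
        (laguerreFun n ((x ^ 2 + y ^ 2) / 2) : ℂ) := by
  have h := apply_physHermite_comp_mul_physHermite_comp (gaussFunctional x y) (x + y * I)
    (gaussFunctional_derivative x y) 0 x n
  have hd : (2 * 0 - (x + y * I)) * (2 * x - (x + y * I)) =
      -(2 * (((x ^ 2 + y ^ 2) / 2 : ℝ) : ℂ)) := by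
    push_cast
    linear_combination (y : ℂ) ^ 2 * I_sq
  rw [map_zero, add_zero, Polynomial.comp_X, hd, ← Finset.sum_mul, gaussFunctional_one] at h
  have hs := congrArg (fun r : ℝ => (r : ℂ))
    (sum_descFactorial_eq_laguerrePoly n ((x ^ 2 + y ^ 2) / 2))
  simp only [ofReal_sum, ofReal_mul, ofReal_pow, ofReal_neg, ofReal_natCast, ofReal_ofNat] at hs
  rw [h, hs, laguerreFun]
  have he : (-((x : ℂ) ^ 2 + y ^ 2) / 4) = ((-((x ^ 2 + y ^ 2) / 2) / 2 : ℝ) : ℂ) := by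
    push_cast
    ring
  rw [he, ← Complex.ofReal_exp]
  push_cast
  ring

theorem hermiteFun_eq (n : ℕ) (u : ℝ) :
    hermiteFun n u = (Real.sqrt π * 2 ^ n * (n.factorial : ℝ)) ^ (-(1 : ℝ) / 2) *
      (physHermite ℝ n).eval u * Real.exp (-u ^ 2 / 2) := by
  rw [hermiteFun, hermitePoly_eq_eval]

theorem ofReal_eval_physHermite (n : ℕ) (u : ℝ) :
    (((physHermite ℝ n).eval u : ℝ) : ℂ) = (physHermite ℂ n).eval (u : ℂ) := by
  rw [← map_physHermite Complex.ofRealHom n]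
  exact (Polynomial.eval_map_apply Complex.ofRealHom u).symm

/-- The Fourier–Wigner transform of a Hermite function is a Laguerre function. -/
theorem integral_hermiteFun_mul_hermiteFun (n : ℕ) (x y : ℝ) :
    ∫ t : ℝ, (hermiteFun n t : ℂ) * (hermiteFun n (t + x) : ℂ) * Complex.exp (-(y * I * t)) =
      Complex.exp (x * y * I / 2) * (laguerreFun n ((x ^ 2 + y ^ 2) / 2) : ℂ) := by
  set N : ℝ := Real.sqrt π * 2 ^ n * (n.factorial : ℝ) with hN
  have hN0 : 0 < N := by positivity
  have hNN : (N ^ (-(1 : ℝ) / 2)) ^ 2 * N = 1 := by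
    rw [← Real.rpow_natCast, ← Real.rpow_mul hN0.le]
    norm_num [Real.rpow_neg_one, hN0.ne']
  have hint : ∀ t : ℝ,
      (hermiteFun n t : ℂ) * (hermiteFun n (t + x) : ℂ) * Complex.exp (-(y * I * t)) =
        (((N ^ (-(1 : ℝ) / 2)) ^ 2 : ℝ) : ℂ) *
          ((physHermite ℂ n * (physHermite ℂ n).comp (.X + .C (x : ℂ))).eval (t : ℂ) *
            gaussWeight x y t) := by
    intro t
    have hexp : gaussWeight x y t = (Real.exp (-t ^ 2 / 2) : ℂ) *
        (Real.exp (-(t + x) ^ 2 / 2) : ℂ) * Complex.exp (-(y * I * t)) := by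
      rw [gaussWeight, Complex.ofReal_exp, Complex.ofReal_exp, ← Complex.exp_add,
        ← Complex.exp_add]
      congr 1
      push_cast
      ring
    rw [hermiteFun_eq, hermiteFun_eq, ← hN, hexp, Polynomial.eval_mul, Polynomial.eval_comp]
    simp only [Polynomial.eval_add, Polynomial.eval_X, Polynomial.eval_C, ← ofReal_add,
      ← ofReal_eval_physHermite]
    simp only [ofReal_mul, ofReal_pow]
    ring
  simp_rw [hint]
  rw [integral_const_mul, ← gaussFunctional_apply, gaussFunctional_physHermite, ← hN,
    ← mul_assoc, ← mul_assoc, ← Complex.ofReal_mul, hNN, Complex.ofReal_one, one_mul]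

/-- The matrix coefficient of the Schrödinger representation against the rescaled
Hermite function is a Laguerre function:
`∫ h_{ℓ,λ}(u) conj(e^{2πiλ(c+ub)} h_{ℓ,λ}(u+a)) du = e^{-2πiλc} e^{πiλba} 𝓛_ℓ(π|λ|(a²+b²))`. -/
theorem schrodinger_matrix_coeff_eq_laguerre (lam : ℤ) (hlam : lam ≠ 0) (ℓ : ℕ) (a b c : ℝ) :
    (∫ u : ℝ, (hermiteScaled ℓ lam u : ℂ) *
        conj (Complex.exp (2 * (π : ℂ) * Complex.I * (lam : ℂ) * ((c : ℂ) + (u : ℂ) * (b : ℂ))) *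
          (hermiteScaled ℓ lam (u + a) : ℂ)))
      = Complex.exp (-(2 * (π : ℂ) * Complex.I * (lam : ℂ) * (c : ℂ))) *
        Complex.exp ((π : ℂ) * Complex.I * (lam : ℂ) * (b : ℂ) * (a : ℂ)) *
        (laguerreFun ℓ (π * |(lam : ℝ)| * (a ^ 2 + b ^ 2)) : ℂ) := by
  have hlam' : (lam : ℝ) ≠ 0 := by exact_mod_cast hlam
  have hM : 0 < 2 * π * |(lam : ℝ)| := by positivity
  set M : ℝ := 2 * π * |(lam : ℝ)| with hMdef
  set s : ℝ := Real.sqrt M with hs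
  have hs0 : 0 < s := Real.sqrt_pos.2 hM
  have hss : s ^ 2 = M := Real.sq_sqrt hM.le
  have hM4 : (M ^ ((1 : ℝ) / 4)) ^ 2 = s := by
    rw [← Real.rpow_natCast, ← Real.rpow_mul hM.le, hs, Real.sqrt_eq_rpow]
    norm_num
  set y : ℝ := 2 * π * lam * b / s with hy
  have hsy : s * y = 2 * π * lam * b := by
    rw [hy]
    field_simp
  have hint : ∀ u : ℝ, (hermiteScaled ℓ lam u : ℂ) *
        conj (Complex.exp (2 * (π : ℂ) * Complex.I * (lam : ℂ) * ((c : ℂ) + (u : ℂ) * (b : ℂ))) *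
          (hermiteScaled ℓ lam (u + a) : ℂ)) =
      (Complex.exp (-(2 * (π : ℂ) * Complex.I * (lam : ℂ) * (c : ℂ))) * (s : ℂ)) *
        (fun t : ℝ => (hermiteFun ℓ t : ℂ) * (hermiteFun ℓ (t + s * a) : ℂ) *
          Complex.exp (-(y * I * t))) (s * u) := by
    intro u
    have hsy' : (s : ℂ) * y = 2 * π * lam * b := by exact_mod_cast congrArg Complex.ofReal hsy
    have hconj : conj (Complex.exp (2 * (π : ℂ) * I * (lam : ℂ) * ((c : ℂ) + (u : ℂ) * (b : ℂ)))) =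
        Complex.exp (-(2 * (π : ℂ) * I * (lam : ℂ) * (c : ℂ))) *
          Complex.exp (-(y * I * ((s * u : ℝ) : ℂ))) := by
      rw [← Complex.exp_conj, ← Complex.exp_add]
      congr 1
      simp only [map_mul, map_add, conj_ofReal, conj_I, map_ofNat, map_intCast, ofReal_mul]
      linear_combination I * u * hsy'
    simp only [map_mul, hconj, conj_ofReal, hermiteScaled, ← hMdef, ← hs]
    rw [mul_add s u a, ← hM4]
    push_cast
    ring
  simp_rw [hint]
  rw [integral_const_mul, Measure.integral_comp_mul_left (fun t : ℝ => (hermiteFun ℓ t : ℂ) *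
    (hermiteFun ℓ (t + s * a) : ℂ) * Complex.exp (-(y * I * t))) s,
    integral_hermiteFun_mul_hermiteFun]
  have hv : ((s * a) ^ 2 + y ^ 2) / 2 = π * |(lam : ℝ)| * (a ^ 2 + b ^ 2) := by
    have hy2 : y ^ 2 = M * b ^ 2 := by
      have h1 : s ^ 2 * y ^ 2 = s ^ 2 * (M * b ^ 2) := by
        rw [← mul_pow, hsy, hss, hMdef]
        linear_combination (-(4 * π ^ 2 * b ^ 2)) * sq_abs (lam : ℝ)
      exact mul_left_cancel₀ (pow_pos hs0 2).ne' h1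
    rw [mul_pow, hss, hy2, hMdef]
    ring
  have hph : ((s * a : ℝ) : ℂ) * y * I / 2 = π * I * lam * b * a := by
    have hsy' : (s : ℂ) * y = 2 * π * lam * b := by exact_mod_cast congrArg Complex.ofReal hsy
    push_cast
    linear_combination a * I / 2 * hsy'
  have hsc : (s : ℂ) * ((s⁻¹ : ℝ) : ℂ) = 1 := by
    rw [← Complex.ofReal_mul, mul_inv_cancel₀ hs0.ne', Complex.ofReal_one]
  rw [hv, hph, abs_of_pos (inv_pos.2 hs0), Complex.real_smul]
  linear_combination (Complex.exp (-(2 * (π : ℂ) * I * lam * c)) *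
    Complex.exp (π * I * lam * b * a) *
    (laguerreFun ℓ (π * |(lam : ℝ)| * (a ^ 2 + b ^ 2)) : ℂ)) * hsc
end

section
/- For every ε > 0 there exists a constant C_ε > 0 such that for every integer λ ≥ 1 and every ℓ ∈ ℕ, the lattice sum of squared Laguerre functions satisfies ∑_{(a,b)∈ℤ²} (𝓛_ℓ(π(a²+b²)/λ))² ≤ C_ε · (λ(2ℓ+1))^{1+ε}. (The sum converges since 𝓛_ℓ decays exponentially.) -/
open Real

/-- The Charlier polynomial of degree `n` with parameter `x`, scaled by `x ^ n`. -/
noncomputable def scaledCharlier (x : ℝ) : ℕ → ℕ → ℝ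
  | 0, _ => 1
  | n + 1, k => x * scaledCharlier x n k - k * scaledCharlier x n (k - 1)

lemma scaledCharlier_succ (x : ℝ) (n k : ℕ) :
    scaledCharlier x (n + 1) k = x * scaledCharlier x n k - k * scaledCharlier x n (k - 1) := by
  rw [scaledCharlier]

lemma scaledCharlier_succ_sub (x : ℝ) (n k : ℕ) :
    scaledCharlier x (n + 1) (k + 1) - scaledCharlier x (n + 1) k =
      -(n + 1) * scaledCharlier x n k := by
  induction n generalizing k with
  | zero => simp [scaledCharlier]
  | succ n ih =>
    rw [scaledCharlier_succ x (n + 1) (k + 1), scaledCharlier_succ x (n + 1) k]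
    have h := ih k
    rcases k with _ | k
    · simp only [Nat.add_sub_cancel]
      push_cast
      have h' := scaledCharlier_succ x n 0
      push_cast at h'
      linear_combination x * h + (n + 1) * h'
    · have h' := ih k
      simp only [Nat.add_sub_cancel]
      have h'' := scaledCharlier_succ x n (k + 1)
      simp only [Nat.add_sub_cancel] at h''
      push_cast at *
      linear_combination x * h - (k + 1) * h' + (n + 1) * h''

lemma scaledCharlier_eq_sum (x : ℝ) (n k : ℕ) :
    scaledCharlier x n k =
      ∑ j ∈ Finset.range (n + 1), (-1) ^ j * n.choose j * k.descFactorial j * x ^ (n - j) := by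
  induction n generalizing k with
  | zero => simp [scaledCharlier]
  | succ n ih =>
    have hdesc (j : ℕ) :
        (k : ℝ) * (k - 1).descFactorial j = k.descFactorial (j + 1) := by
      rcases k with _ | k
      · simp
      · rw [Nat.succ_descFactorial_succ]; push_cast; simp
    have hfirst : x * ∑ j ∈ Finset.range (n + 1),
          (-1) ^ j * n.choose j * k.descFactorial j * x ^ (n - j) =
        ∑ j ∈ Finset.range (n + 2),
          (-1) ^ j * n.choose j * k.descFactorial j * x ^ (n + 1 - j) := by
      rw [Finset.sum_range_succ _ (n + 1), Nat.choose_succ_self, Finset.mul_sum]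
      simp only [Nat.cast_zero, mul_zero, zero_mul, add_zero]
      refine Finset.sum_congr rfl fun j hj => ?_
      rw [Nat.sub_add_comm (Nat.lt_succ_iff.1 (Finset.mem_range.1 hj)), pow_succ]
      ring
    rw [scaledCharlier, ih, ih, hfirst, Finset.sum_range_succ', Finset.sum_range_succ' _ (n + 1),
      Finset.mul_sum, add_sub_right_comm, ← Finset.sum_sub_distrib]
    congr 1
    · refine Finset.sum_congr rfl fun j _ => ?_
      rw [← hdesc j, Nat.choose_succ_succ, Nat.add_sub_add_right]
      push_cast
      ring
    · simp

lemma scaledCharlier_self (x : ℝ) (n : ℕ) :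
    scaledCharlier x n n = (-1) ^ n * n.factorial * laguerrePoly n x := by
  rw [scaledCharlier_eq_sum, laguerrePoly, Finset.mul_sum, ← Finset.sum_range_reflect]
  refine Finset.sum_congr rfl fun j hj => ?_
  have hj' : j ≤ n := Nat.lt_succ_iff.1 (Finset.mem_range.1 hj)
  have h1 : n + 1 - 1 - j = n - j := by omega
  have h2 : n - (n - j) = j := by omega
  have h3 : (n.descFactorial (n - j) : ℝ) * j.factorial = n.factorial := by
    have := Nat.factorial_mul_descFactorial (Nat.sub_le n j)
    rw [h2] at this
    rw [mul_comm]
    exact_mod_cast this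
  have h4 : ((-1 : ℝ)) ^ (n - j) = (-1) ^ n * (-1) ^ j := by
    rw [← pow_add, show n + j = (n - j) + 2 * j by omega, pow_add, pow_mul]
    simp
  rw [h1, h2, h4, ← h3]
  field_simp

lemma abs_scaledCharlier_le {x : ℝ} (hx : 0 ≤ x) (n k : ℕ) :
    |scaledCharlier x n k| ≤ (x + k) ^ n := by
  induction n generalizing k with
  | zero => simp [scaledCharlier]
  | succ n ih =>
    have hle : (x + (k - 1 : ℕ)) ^ n ≤ (x + k) ^ n := by
      gcongr
      exact Nat.sub_le k 1
    calc |scaledCharlier x (n + 1) k|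
        ≤ |x * scaledCharlier x n k| + |k * scaledCharlier x n (k - 1)| := abs_sub _ _
      _ = x * |scaledCharlier x n k| + k * |scaledCharlier x n (k - 1)| := by
        rw [abs_mul, abs_mul, abs_of_nonneg hx, Nat.abs_cast]
      _ ≤ x * (x + k) ^ n + k * (x + k) ^ n := by
        gcongr
        · exact ih k
        · exact (ih _).trans hle
      _ = (x + k) ^ (n + 1) := by ring

lemma summable_scaledCharlier_mul {x : ℝ} (hx : 0 ≤ x) (m n : ℕ) :
    Summable fun k : ℕ =>
      x ^ k / k.factorial * (scaledCharlier x m k * scaledCharlier x n k) := by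
  have hs := (Real.summable_pow_div_factorial (exp 1 * x)).mul_left
    ((m + n).factorial * exp x)
  refine Summable.of_norm_bounded hs fun k => ?_
  have hfac : (x + k) ^ (m + n) ≤ (m + n).factorial * exp (x + k) := by
    have := Real.pow_div_factorial_le_exp (x + k) (by positivity) (m + n)
    rwa [div_le_iff₀' (by positivity)] at this
  rw [Real.norm_eq_abs, abs_mul, abs_mul, abs_of_nonneg (by positivity : 0 ≤ x ^ k / k.factorial)]
  calc x ^ k / k.factorial * (|scaledCharlier x m k| * |scaledCharlier x n k|)
      ≤ x ^ k / k.factorial * ((x + k) ^ m * (x + k) ^ n) := by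
        gcongr <;> exact abs_scaledCharlier_le hx _ _
    _ ≤ x ^ k / k.factorial * ((m + n).factorial * exp (x + k)) := by
        rw [← pow_add]
        gcongr
    _ = _ := by
        rw [Real.exp_add, mul_pow, ← Real.exp_nat_mul, mul_one]
        ring

lemma tsum_scaledCharlier_sq {x : ℝ} (hx : 0 ≤ x) (n : ℕ) :
    ∑' k : ℕ, x ^ k / k.factorial * (scaledCharlier x n k * scaledCharlier x n k) =
      n.factorial * x ^ n * exp x := by
  induction n with
  | zero =>
    simp [scaledCharlier, Real.exp_eq_exp_ℝ, NormedSpace.exp_eq_tsum_div]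
  | succ n ih =>
    have hsq := summable_scaledCharlier_mul hx (n + 1) (n + 1)
    have hcross := (summable_scaledCharlier_mul hx n (n + 1)).mul_left x
    have hlow := (summable_scaledCharlier_mul hx n n).mul_left (x * (n + 1))
    set h : ℕ → ℝ := fun k =>
      x ^ k / k.factorial * (k * scaledCharlier x n (k - 1) * scaledCharlier x (n + 1) k) with hh
    have hsplit (k : ℕ) :
        x ^ k / k.factorial * (scaledCharlier x (n + 1) k * scaledCharlier x (n + 1) k) =
          x * (x ^ k / k.factorial * (scaledCharlier x n k * scaledCharlier x (n + 1) k)) - h k := by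
      simp only [hh]
      nth_rewrite 1 [scaledCharlier_succ]
      ring
    have hshift (k : ℕ) : h (k + 1) =
        x * (x ^ k / k.factorial * (scaledCharlier x n k * scaledCharlier x (n + 1) k)) -
          x * (n + 1) *
            (x ^ k / k.factorial * (scaledCharlier x n k * scaledCharlier x n k)) := by
      have hd : scaledCharlier x (n + 1) (k + 1) =
          scaledCharlier x (n + 1) k - (n + 1) * scaledCharlier x n k := by
        linear_combination scaledCharlier_succ_sub x n k
      simp only [hh, Nat.add_sub_cancel, hd, Nat.factorial_succ]
      push_cast
      field_simp
      ring
    have hsum : Summable h :=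
      (hcross.sub hsq).congr fun k => by rw [hsplit]; ring
    rw [tsum_congr hsplit, hcross.tsum_sub hsum, hsum.tsum_eq_zero_add, tsum_congr hshift,
      hcross.tsum_sub hlow, tsum_mul_left (a := x * (n + 1)), ih]
    simp only [hh, Nat.factorial_succ]
    push_cast
    ring

lemma laguerreFun_sq_le_one (n : ℕ) {x : ℝ} (hx : 0 ≤ x) : laguerreFun n x ^ 2 ≤ 1 := by
  have hexp : laguerreFun n x ^ 2 = laguerrePoly n x ^ 2 * exp (-x) := by
    rw [laguerreFun, mul_pow, ← Real.exp_nat_mul]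
    congr 2
    push_cast
    ring
  rcases hx.eq_or_lt with rfl | hpos
  · have : laguerrePoly n 0 = 1 := by
      rw [laguerrePoly, Finset.sum_range_succ']
      simp
    simp [hexp, this]
  · have hterm := (summable_scaledCharlier_mul hx n n).le_tsum n
      fun k _ => mul_nonneg (by positivity) (mul_self_nonneg _)
    rw [tsum_scaledCharlier_sq hx, scaledCharlier_self] at hterm
    have hone : ((-1 : ℝ) ^ n) ^ 2 = 1 := by rw [← pow_mul, mul_comm, pow_mul]; simp
    have hterm' : (n.factorial * x ^ n) * laguerrePoly n x ^ 2 ≤ n.factorial * x ^ n * exp x := by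
      refine le_of_eq_of_le ?_ hterm
      field_simp
      linear_combination -laguerrePoly n x ^ 2 * hone
    have hle := le_of_mul_le_mul_left hterm' (by positivity)
    rw [hexp, Real.exp_neg, ← div_eq_mul_inv]
    exact (div_le_one (exp_pos x)).2 hle

lemma abs_laguerrePoly_le (n : ℕ) {x : ℝ} (hx : 0 ≤ x) :
    |laguerrePoly n x| ≤ 5 ^ n * exp (x / 4) := by
  have hsum : (5 : ℝ) ^ n * exp (x / 4) =
      ∑ k ∈ Finset.range (n + 1), n.choose k * 4 ^ k * exp (x / 4) := by
    rw [← Finset.sum_mul, show (5 : ℝ) = 4 + 1 by norm_num, add_pow]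
    congr 1
    exact Finset.sum_congr rfl fun k _ => by rw [one_pow]; ring
  rw [hsum, laguerrePoly]
  refine (Finset.abs_sum_le_sum_abs _ _).trans (Finset.sum_le_sum fun k hk => ?_)
  rw [Nat.choose_symm (Nat.lt_succ_iff.1 (Finset.mem_range.1 hk))]
  have habs : |(-1 : ℝ) ^ k * n.choose k * x ^ k / k.factorial| =
      n.choose k * 4 ^ k * ((x / 4) ^ k / k.factorial) := by
    rw [abs_div, abs_mul, abs_mul, abs_pow, abs_neg, abs_one, one_pow, one_mul, Nat.abs_cast,
      Nat.abs_cast, abs_of_nonneg (by positivity : 0 ≤ x ^ k), div_pow]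
    field_simp
  rw [habs]
  gcongr
  exact Real.pow_div_factorial_le_exp _ (by positivity) _

lemma laguerreFun_sq_le_exp (n : ℕ) {x : ℝ} (hx : 0 ≤ x) :
    laguerreFun n x ^ 2 ≤ 25 * exp (-x / (2 * (n + 1))) := by
  have htail : laguerreFun n x ^ 2 ≤ 25 ^ n * exp (-x / 2) := by
    rw [laguerreFun, mul_pow, ← sq_abs (laguerrePoly n x)]
    calc |laguerrePoly n x| ^ 2 * exp (-x / 2) ^ 2
        ≤ (5 ^ n * exp (x / 4)) ^ 2 * exp (-x / 2) ^ 2 := by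
          gcongr
          exact abs_laguerrePoly_le n hx
      _ = 25 ^ n * exp (-x / 2) := by
          rw [mul_pow, ← pow_mul, mul_comm n 2, pow_mul, ← Real.exp_nat_mul, ← Real.exp_nat_mul,
            mul_assoc, ← Real.exp_add]
          norm_num
          ring
  by_contra! hlt
  have hpow : (25 * exp (-x / (2 * (n + 1)))) ^ (n + 1) = 25 ^ (n + 1) * exp (-x / 2) := by
    rw [mul_pow, ← Real.exp_nat_mul]
    congr 2
    push_cast
    field_simp
  have h1 := pow_lt_pow_left₀ hlt (by positivity) n.succ_ne_zero
  have h2 := pow_le_of_le_one (sq_nonneg _) (laguerreFun_sq_le_one n hx) n.succ_ne_zero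
  have h3 : (25 : ℝ) ^ n * exp (-x / 2) ≤ 25 ^ (n + 1) * exp (-x / 2) := by
    gcongr <;> norm_num
  rw [Nat.succ_eq_add_one] at h1 h2
  rw [hpow] at h1
  linarith

lemma summable_exp_neg_pi_mul_int_sq {a : ℝ} (ha : 0 < a) :
    Summable fun n : ℤ => exp (-π * a * (n : ℝ) ^ 2) := by
  have h := (summable_pow_mul_jacobiTheta₂_term_bound 0 ha 0)
  refine h.congr fun n => ?_
  simp
  ring_nf

lemma tsum_exp_neg_pi_mul_int_sq_le {T : ℝ} (hT : 1 ≤ T) :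
    ∑' n : ℤ, exp (-π * T⁻¹ * (n : ℝ) ^ 2) ≤ √T * ∑' n : ℤ, exp (-π * 1 * (n : ℝ) ^ 2) := by
  have hT0 : 0 < T := by linarith
  rw [Real.tsum_exp_neg_mul_int_sq (inv_pos.2 hT0), ← Real.sqrt_eq_rpow, Real.sqrt_inv, one_div,
    inv_inv]
  simp only [div_inv_eq_mul]
  refine mul_le_mul_of_nonneg_left ?_ (sqrt_nonneg T)
  refine (summable_exp_neg_pi_mul_int_sq hT0).tsum_le_tsum (fun n => ?_)
    (summable_exp_neg_pi_mul_int_sq one_pos)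
  rw [Real.exp_le_exp]
  have := mul_le_mul_of_nonneg_left hT (by positivity : 0 ≤ π * (n : ℝ) ^ 2)
  linarith

/-- For every `ε > 0` there is `C_ε > 0` such that for every integer `λ ≥ 1` and every
`ℓ ∈ ℕ`, `∑_{(a,b) ∈ ℤ²} 𝓛_ℓ(π(a²+b²)/λ)² ≤ C_ε (λ(2ℓ+1))^{1+ε}`. -/
theorem laguerre_lattice_sum_bound (ε : ℝ) (hε : 0 < ε) :
    ∃ C > (0 : ℝ), ∀ (lam : ℕ), 1 ≤ lam → ∀ ℓ : ℕ,
      (∑' ab : ℤ × ℤ, (laguerreFun ℓ (π * ((ab.1 : ℝ) ^ 2 + (ab.2 : ℝ) ^ 2) / (lam : ℝ))) ^ 2)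
        ≤ C * ((lam : ℝ) * (2 * (ℓ : ℝ) + 1)) ^ (1 + ε) := by
  set S : ℝ := ∑' n : ℤ, exp (-π * 1 * (n : ℝ) ^ 2) with hS
  have hSpos : 0 < S :=
    (summable_exp_neg_pi_mul_int_sq one_pos).tsum_pos (fun n => (exp_pos _).le) 0 (exp_pos _)
  refine ⟨50 * S ^ 2, by positivity, fun lam hlam ℓ => ?_⟩
  have hlam' : (1 : ℝ) ≤ lam := by exact_mod_cast hlam
  set T : ℝ := 2 * lam * (ℓ + 1) with hT
  have hℓ : (0 : ℝ) ≤ ℓ := ℓ.cast_nonneg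
  have hT1 : 1 ≤ T := by nlinarith
  have hT0 : 0 < T := by linarith
  have hgauss := summable_exp_neg_pi_mul_int_sq (inv_pos.2 hT0)
  have hprod : Summable fun ab : ℤ × ℤ =>
      exp (-π * T⁻¹ * (ab.1 : ℝ) ^ 2) * exp (-π * T⁻¹ * (ab.2 : ℝ) ^ 2) :=
    hgauss.mul_of_nonneg hgauss (fun _ => (exp_pos _).le) (fun _ => (exp_pos _).le)
  have hbound (ab : ℤ × ℤ) :
      laguerreFun ℓ (π * ((ab.1 : ℝ) ^ 2 + (ab.2 : ℝ) ^ 2) / lam) ^ 2 ≤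
        25 * (exp (-π * T⁻¹ * (ab.1 : ℝ) ^ 2) * exp (-π * T⁻¹ * (ab.2 : ℝ) ^ 2)) := by
    refine (laguerreFun_sq_le_exp ℓ (by positivity)).trans_eq ?_
    rw [← Real.exp_add]
    congr 2
    rw [hT]
    field_simp
    ring
  have hsummable : Summable fun ab : ℤ × ℤ =>
      laguerreFun ℓ (π * ((ab.1 : ℝ) ^ 2 + (ab.2 : ℝ) ^ 2) / lam) ^ 2 :=
    (hprod.mul_left 25).of_nonneg_of_le (fun _ => sq_nonneg _) hbound
  have hbase : 1 ≤ (lam : ℝ) * (2 * ℓ + 1) := by nlinarith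
  calc ∑' ab : ℤ × ℤ, laguerreFun ℓ (π * ((ab.1 : ℝ) ^ 2 + (ab.2 : ℝ) ^ 2) / lam) ^ 2
      ≤ ∑' ab : ℤ × ℤ,
          25 * (exp (-π * T⁻¹ * (ab.1 : ℝ) ^ 2) * exp (-π * T⁻¹ * (ab.2 : ℝ) ^ 2)) :=
        hsummable.tsum_le_tsum hbound (hprod.mul_left 25)
    _ = 25 * (∑' n : ℤ, exp (-π * T⁻¹ * (n : ℝ) ^ 2)) ^ 2 := by
        rw [tsum_mul_left, sq, hgauss.tsum_mul_tsum hgauss hprod]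
    _ ≤ 25 * (√T * S) ^ 2 := by
        gcongr
        exact tsum_exp_neg_pi_mul_int_sq_le hT1
    _ = 25 * S ^ 2 * T := by rw [mul_pow, Real.sq_sqrt hT0.le]; ring
    _ ≤ 25 * S ^ 2 * (2 * (lam * (2 * ℓ + 1))) := by
        gcongr
        rw [hT]
        nlinarith
    _ = 50 * S ^ 2 * (lam * (2 * ℓ + 1)) := by ring
    _ ≤ 50 * S ^ 2 * (lam * (2 * ℓ + 1)) ^ (1 + ε) := by
        gcongr
        exact Real.self_le_rpow_of_one_le hbase (by linarith)
end

section
/- (L⁴ identity for superpositions of BWZ transforms.) Let λ ∈ ℤ∖{0}, let h : ℝ → ℂ be a Schwartz function, and let γ : ℤ/λℤ → ℂ. Then ∫_{[0,1]³} |∑_{q∈ℤ/λℤ} γ(q) · BWZ_{λ,q}(h)(a,b,c)|⁴ da db dc = ∑_{(a,b)∈ℤ²} | (∑_{q∈ℤ/λℤ} γ(q) conj(γ(q−b)) e^{2πiqa/λ}) · ∫_ℝ h(u) conj(e^{2πiub} h(u + a/λ)) du |², where in the inner sums q−b means subtraction in ℤ/λℤ and e^{2πiqa/λ} is well defined for q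 ∈ ℤ/λℤ since a ∈ ℤ. -/
open MeasureTheory Real Complex
open scoped ComplexConjugate

/-- The generalised Berezin–Weil–Zak transform
`BWZ_{λ,q}(h)(a,b,c) = (√|λ|/λ) ∑_{k∈ℤ} e^{-2πiqk/λ} e^{2πi(λc+kb)} h(k/λ + a)`. -/
noncomputable def BWZ (lam q : ℤ) (h : ℝ → ℂ) (x : ℝ × ℝ × ℝ) : ℂ :=
  ((Real.sqrt |(lam : ℝ)| : ℝ) / (lam : ℝ) : ℝ) *
    ∑' k : ℤ, Complex.exp (-(2 * (π : ℂ) * Complex.I * (q : ℂ) * (k : ℂ)) / (lam : ℂ)) *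
      Complex.exp (2 * (π : ℂ) * Complex.I * ((lam : ℂ) * (x.2.2 : ℂ) + (k : ℂ) * (x.2.1 : ℂ))) *
      h ((k : ℝ) / (lam : ℝ) + x.1)

/-- The character `x ↦ e^{2πix}` of the real line. -/
noncomputable def unitExp (x : ℝ) : ℂ := Complex.exp (2 * (π : ℂ) * Complex.I * (x : ℂ))

lemma unitExp_add (x y : ℝ) : unitExp (x + y) = unitExp x * unitExp y := by
  simp only [unitExp, ← Complex.exp_add]
  push_cast
  ring_nf

lemma unitExp_intCast (n : ℤ) : unitExp n = 1 := by
  rw [unitExp, Complex.exp_eq_one_iff]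
  exact ⟨n, by push_cast; ring⟩

lemma unitExp_zero : unitExp 0 = 1 := by simp [unitExp]

lemma unitExp_add_intCast (x : ℝ) (n : ℤ) : unitExp (x + n) = unitExp x := by
  rw [unitExp_add, unitExp_intCast, mul_one]

lemma conj_unitExp (x : ℝ) : conj (unitExp x) = unitExp (-x) := by
  rw [unitExp, unitExp, ← Complex.exp_conj]
  simp only [map_mul, Complex.conj_I, Complex.conj_ofReal, map_ofNat]
  push_cast
  ring_nf

@[simp]
lemma norm_unitExp (x : ℝ) : ‖unitExp x‖ = 1 := by
  rw [unitExp, show 2 * (π : ℂ) * Complex.I * (x : ℂ) = ((2 * π * x : ℝ) : ℂ) * Complex.I by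
    push_cast; ring, Complex.norm_exp_ofReal_mul_I]

@[fun_prop]
lemma continuous_unitExp : Continuous unitExp := by
  unfold unitExp
  fun_prop

lemma unitExp_nat_mul (n : ℕ) (x : ℝ) : unitExp (n * x) = unitExp x ^ n := by
  rw [unitExp, unitExp, ← Complex.exp_nat_mul]
  push_cast
  ring_nf

lemma unitExp_eq_one_iff (x : ℝ) : unitExp x = 1 ↔ ∃ n : ℤ, x = n := by
  refine ⟨fun hx => ?_, fun ⟨n, hn⟩ => hn ▸ unitExp_intCast n⟩
  obtain ⟨n, hn⟩ := Complex.exp_eq_one_iff.1 hx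
  refine ⟨n, ?_⟩
  have h2 : 2 * (π : ℂ) * Complex.I ≠ 0 := by simp [Real.pi_ne_zero]
  have h3 : (x : ℂ) = n := mul_left_cancel₀ h2 (by rw [hn]; ring)
  exact_mod_cast h3

lemma integral_unitExp_intCast_mul (n : ℤ) :
    ∫ x in (0:ℝ)..1, unitExp (n * x) = if n = 0 then 1 else 0 := by
  split_ifs with hn
  · simp [hn, unitExp_zero]
  · have hc : 2 * (π : ℂ) * Complex.I * n ≠ 0 := by simp [Real.pi_ne_zero, hn]
    have := integral_exp_mul_complex (a := 0) (b := 1) hc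
    have h1 : Complex.exp (2 * (π : ℂ) * Complex.I * n) = 1 := by
      simpa [unitExp] using unitExp_intCast n
    simp only [Complex.ofReal_one, mul_one, h1, Complex.ofReal_zero, mul_zero, Complex.exp_zero,
      sub_self, zero_div] at this
    rw [← this]
    refine intervalIntegral.integral_congr fun x _ => ?_
    simp only [unitExp]
    push_cast
    ring_nf

/-- **Parseval's identity** on the unit interval. -/
lemma hasSum_sq_norm_integral_unitExp_mul {f : ℝ → ℂ} (hf : ContinuousOn f (Set.Icc 0 1)) :
    HasSum (fun n : ℤ => ‖∫ x in (0:ℝ)..1, unitExp (-(n * x)) * f x‖ ^ 2)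
      (∫ x in Set.Icc (0:ℝ) 1, ‖f x‖ ^ 2) := by
  have hL : MemLp f 2 (volume.restrict (Set.Ioc 0 1)) := by
    obtain ⟨C, hC⟩ := isCompact_Icc.exists_bound_of_continuousOn hf
    refine MemLp.of_bound ((hf.mono Set.Ioc_subset_Icc_self).aestronglyMeasurable
      measurableSet_Ioc) C ?_
    exact (ae_restrict_iff' measurableSet_Ioc).2
      (ae_of_all _ fun x hx => hC x (Set.Ioc_subset_Icc_self hx))
  have := hasSum_sq_fourierCoeffOn (zero_lt_one' ℝ) hL
  rw [intervalIntegral.integral_of_le zero_le_one, ← integral_Icc_eq_integral_Ioc] at this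
  simp only [sub_zero, inv_one, one_smul] at this
  convert this using 5 with n
  rw [fourierCoeffOn_eq_integral]
  simp only [sub_zero, div_one, one_smul, smul_eq_mul]
  refine intervalIntegral.integral_congr fun x _ => ?_
  simp only [fourier_coe_apply, unitExp]
  push_cast
  ring_nf

/-- **Iterated Parseval identity** on the unit square. -/
lemma integral_integral_sq_norm_eq_tsum {f : ℝ → ℝ → ℂ} {ψ : ℤ → ℝ → ℂ}
    (hf : ∀ a ∈ Set.Icc (0:ℝ) 1, ContinuousOn (f a) (Set.Icc 0 1))
    (hfψ : ∀ l : ℤ, ∀ a ∈ Set.Icc (0:ℝ) 1,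
      ∫ b in (0:ℝ)..1, unitExp (-(l * b)) * f a b = ψ l a)
    (hψ : ∀ l, ContinuousOn (ψ l) (Set.Icc 0 1)) :
    ∫ a in Set.Icc (0:ℝ) 1, ∫ b in Set.Icc (0:ℝ) 1, ‖f a b‖ ^ 2 =
      ∑' p : ℤ × ℤ, ‖∫ a in (0:ℝ)..1, unitExp (-(p.2 * a)) * ψ p.1 a‖ ^ 2 := by
  have hsum (a : ℝ) (ha : a ∈ Set.Icc (0:ℝ) 1) :
      HasSum (fun l => ‖ψ l a‖ ^ 2) (∫ b in Set.Icc (0:ℝ) 1, ‖f a b‖ ^ 2) := by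
    simpa only [hfψ _ a ha] using hasSum_sq_norm_integral_unitExp_mul (hf a ha)
  have hmeas (l : ℤ) : AEMeasurable (fun a => ENNReal.ofReal (‖ψ l a‖ ^ 2))
      (volume.restrict (Set.Icc (0:ℝ) 1)) :=
    (((hψ l).norm.pow 2).aemeasurable measurableSet_Icc).ennreal_ofReal
  have hS (a : ℝ) (ha : a ∈ Set.Icc (0:ℝ) 1) :
      ∑' l, ENNReal.ofReal (‖ψ l a‖ ^ 2) =
        ENNReal.ofReal (∫ b in Set.Icc (0:ℝ) 1, ‖f a b‖ ^ 2) := by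
    rw [← (hsum a ha).tsum_eq, ENNReal.ofReal_tsum_of_nonneg (fun _ => by positivity)
      (hsum a ha).summable]
  have hleft : ∫ a in Set.Icc (0:ℝ) 1, ∫ b in Set.Icc (0:ℝ) 1, ‖f a b‖ ^ 2 =
      ∫ a in Set.Icc (0:ℝ) 1, (∑' l, ENNReal.ofReal (‖ψ l a‖ ^ 2)).toReal := by
    refine setIntegral_congr_fun measurableSet_Icc fun a ha => ?_
    simp only [hS a ha]
    rw [ENNReal.toReal_ofReal (integral_nonneg fun _ => by positivity)]
  rw [hleft, integral_toReal (AEMeasurable.tsum hmeas)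
    ((ae_restrict_iff' measurableSet_Icc).2
      (ae_of_all _ fun a ha => by rw [hS a ha]; exact ENNReal.ofReal_lt_top)),
    lintegral_tsum hmeas]
  have hl (l : ℤ) : ∫⁻ a in Set.Icc (0:ℝ) 1, ENNReal.ofReal (‖ψ l a‖ ^ 2) =
      ∑' m : ℤ, ENNReal.ofReal (‖∫ a in (0:ℝ)..1, unitExp (-(m * a)) * ψ l a‖ ^ 2) := by
    have hP := hasSum_sq_norm_integral_unitExp_mul (hψ l)
    rw [← ENNReal.ofReal_tsum_of_nonneg (fun _ => by positivity) hP.summable, hP.tsum_eq]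
    have hint : IntegrableOn (fun a => ‖ψ l a‖ ^ 2) (Set.Icc 0 1) :=
      ((hψ l).norm.pow 2).integrableOn_compact isCompact_Icc
    exact (ofReal_integral_eq_lintegral_ofReal hint (ae_of_all _ fun _ => by positivity)).symm
  simp only [hl]
  rw [← ENNReal.tsum_prod (f := fun l m : ℤ =>
      ENNReal.ofReal (‖∫ a in (0:ℝ)..1, unitExp (-(m * a)) * ψ l a‖ ^ 2)),
    ENNReal.tsum_toReal_eq fun _ => ENNReal.ofReal_ne_top]
  exact tsum_congr fun p => ENNReal.toReal_ofReal (by positivity)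

lemma hasSum_integral_mul_tsum {g : ℝ → ℂ} (hg : Continuous g) {F : ℤ → ℝ → ℂ}
    (hF : ∀ k, Continuous (F k)) {u : ℤ → ℝ} (hu : Summable u)
    (hFu : ∀ k, ∀ x ∈ Set.Icc (0:ℝ) 1, ‖F k x‖ ≤ u k) :
    HasSum (fun k => ∫ x in (0:ℝ)..1, g x * F k x) (∫ x in (0:ℝ)..1, g x * ∑' k, F k x) := by
  obtain ⟨C, hC⟩ := isCompact_Icc.exists_bound_of_continuousOn (hg.continuousOn (s := Set.Icc 0 1))
  have hIoc : Set.uIoc (0:ℝ) 1 ⊆ Set.Icc 0 1 := by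
    rw [Set.uIoc_of_le zero_le_one]; exact Set.Ioc_subset_Icc_self
  refine intervalIntegral.hasSum_integral_of_dominated_convergence (fun k _ => C * u k)
    (fun k => (hg.mul (hF k)).aestronglyMeasurable) (fun k => ae_of_all _ fun x hx => ?_)
    (ae_of_all _ fun x _ => hu.mul_left C) intervalIntegrable_const
    (ae_of_all _ fun x hx => ?_)
  · rw [norm_mul]
    have := hC x (hIoc hx)
    exact mul_le_mul this (hFu k x (hIoc hx)) (norm_nonneg _) ((norm_nonneg _).trans this)
  · exact (Summable.of_norm_bounded hu fun k => hFu k x (hIoc hx)).hasSum.mul_left _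

lemma integral_unitExp_mul_tsum {c : ℤ → ℂ} (hc : Summable fun k => ‖c k‖) (l : ℤ) :
    ∫ x in (0:ℝ)..1, unitExp (-(l * x)) * ∑' k, c k * unitExp (k * x) = c l := by
  have := hasSum_integral_mul_tsum (g := fun x => unitExp (-(l * x))) (by fun_prop)
    (F := fun k x => c k * unitExp (k * x)) (by fun_prop) hc (fun k x _ => by simp)
  rw [← this.tsum_eq, tsum_eq_single l]
  · simp [mul_left_comm, ← unitExp_add, unitExp_zero]
  · intro k hk
    have h1 (x : ℝ) : unitExp (-(l * x)) * (c k * unitExp (k * x)) =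
        c k * unitExp ((k - l : ℤ) * x) := by
      rw [mul_left_comm, ← unitExp_add]; push_cast; ring_nf
    simp only [h1]
    rw [intervalIntegral.integral_const_mul, integral_unitExp_intCast_mul,
      if_neg (sub_ne_zero.2 hk), mul_zero]

lemma continuous_tsum_mul_unitExp {c : ℤ → ℂ} (hc : Summable fun k => ‖c k‖) :
    Continuous fun x : ℝ => ∑' k : ℤ, c k * unitExp (k * x) :=
  continuous_tsum (by fun_prop) hc (fun k x => by simp)

/-- The Fourier coefficients of `|f|²`, for an absolutely convergent Fourier series `f`. -/
lemma integral_unitExp_mul_sq_norm_tsum {c : ℤ → ℂ} (hc : Summable fun k => ‖c k‖) (l : ℤ) :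
    ∫ x in (0:ℝ)..1, unitExp (-(l * x)) * ((‖∑' k, c k * unitExp (k * x)‖ ^ 2 : ℝ) : ℂ) =
      ∑' k, c k * conj (c (k - l)) := by
  set f : ℝ → ℂ := fun x => ∑' k, c k * unitExp (k * x) with hf
  have hfc : Continuous f := continuous_tsum_mul_unitExp hc
  have := hasSum_integral_mul_tsum (g := fun x => unitExp (-(l * x)) * conj (f x)) (by fun_prop)
    (F := fun k x => c k * unitExp (k * x)) (by fun_prop) hc (fun k x _ => by simp)
  have h1 (x : ℝ) : unitExp (-(l * x)) * ((‖f x‖ ^ 2 : ℝ) : ℂ) =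
      unitExp (-(l * x)) * conj (f x) * ∑' k, c k * unitExp (k * x) := by
    change _ = _ * f x
    rw [mul_assoc, mul_comm (conj (f x)), Complex.mul_conj, Complex.normSq_eq_norm_sq]
  rw [intervalIntegral.integral_congr fun x _ => h1 x, ← this.tsum_eq]
  refine tsum_congr fun k => ?_
  have h2 (x : ℝ) : unitExp (-(l * x)) * conj (f x) * (c k * unitExp (k * x)) =
      c k * conj (unitExp (-((k - l : ℤ) * x)) * f x) := by
    rw [map_mul, conj_unitExp, neg_neg, Int.cast_sub, sub_mul, sub_eq_neg_add, unitExp_add]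
    ring
  rw [intervalIntegral.integral_congr fun x _ => h2 x, intervalIntegral.integral_const_mul,
    intervalIntegral.intervalIntegral_conj, integral_unitExp_mul_tsum hc]

lemma tsum_int_eq_sum_range_tsum {f : ℤ → ℂ} (hf : Summable f) {d : ℤ} (hd : d ≠ 0) :
    ∑' k, f k = ∑ j ∈ Finset.range d.natAbs, ∑' r : ℤ, f (j + d * r) := by
  have : NeZero d.natAbs := ⟨Int.natAbs_ne_zero.2 hd⟩
  have hpos : ∑' k, f k = ∑ j ∈ Finset.range d.natAbs, ∑' r : ℤ, f (j + d.natAbs * r) := by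
    rw [← (Int.divModEquiv d.natAbs).symm.tsum_eq, ← (Equiv.prodComm (Fin d.natAbs) ℤ).tsum_eq,
      Summable.tsum_prod, tsum_fintype, Finset.sum_range]
    · refine Finset.sum_congr rfl fun j _ => tsum_congr fun r => ?_
      congr 1
      change r * (d.natAbs : ℤ) + j = _
      ring
    · exact (Equiv.summable_iff _).2 ((Equiv.summable_iff _).2 hf)
  rw [hpos]
  refine Finset.sum_congr rfl fun j _ => ?_
  rcases Int.natAbs_eq d with h | h
  · rw [← h]
  · rw [← (Equiv.neg ℤ).tsum_eq]
    refine tsum_congr fun r => congrArg f ?_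
    have : (d.natAbs : ℤ) = -d := by lia
    simp [this]

/-- The Fourier coefficients of a weighted periodisation over the lattice `d⁻¹ℤ`, for weights that
are periodic modulo `d`. -/
lemma integral_unitExp_mul_tsum_comp_add {d : ℤ} (hd : d ≠ 0) {A : ℤ → ℂ}
    (hA : ∀ j r, A (j + d * r) = A j) {H : ℝ → ℂ} (hH : Continuous H) (hHi : Integrable H)
    {u : ℤ → ℝ} (hu : Summable u)
    (hHu : ∀ k : ℤ, ∀ x ∈ Set.Icc (0:ℝ) 1, ‖A k * H (k / d + x)‖ ≤ u k) (m : ℤ) :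
    ∫ x in (0:ℝ)..1, unitExp (-(m * x)) * ∑' k : ℤ, A k * H (k / d + x) =
      (∑ j ∈ Finset.range d.natAbs, A j * unitExp (m * j / d)) *
        ∫ x, unitExp (-(m * x)) * H x := by
  have hd' : (d : ℝ) ≠ 0 := Int.cast_ne_zero.2 hd
  have hsum := hasSum_integral_mul_tsum (g := fun x => unitExp (-(m * x))) (by fun_prop)
    (F := fun k x => A k * H (k / d + x)) (by fun_prop) hu hHu
  rw [← hsum.tsum_eq, tsum_int_eq_sum_range_tsum hsum.summable hd, Finset.sum_mul]
  refine Finset.sum_congr rfl fun j _ => ?_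
  have hi : Integrable fun x => unitExp (-(m * x)) * H x :=
    hHi.bdd_mul (c := 1) (Continuous.aestronglyMeasurable (by fun_prop))
      (ae_of_all _ fun x => by simp)
  have key := (hi.comp_add_right ((j : ℝ) / d)).hasSum_intervalIntegral_comp_add_int
  rw [integral_add_right_eq_self (fun x => unitExp (-(m * x)) * H x)] at key
  rw [← key.tsum_eq, ← tsum_mul_left]
  refine tsum_congr fun r => ?_
  rw [← intervalIntegral.integral_const_mul]
  refine intervalIntegral.integral_congr fun x _ => ?_
  simp only [hA]
  have h1 : (((j + d * r : ℤ) : ℝ) / d + x) = x + r + j / d := by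
    push_cast; field_simp; ring
  have h2 : unitExp (-(m * x)) = unitExp (m * j / d) * unitExp (-(m * (x + r + j / d))) := by
    rw [← unitExp_add, ← unitExp_add_intCast _ (-(m * r))]
    congr 1
    push_cast; ring
  rw [h1, h2]
  ring

lemma SchwartzMap.exists_summable_bound (h : SchwartzMap ℝ ℂ) {d : ℤ} (hd : d ≠ 0) :
    ∃ u : ℤ → ℝ, Summable u ∧ ∀ k : ℤ, ∀ x ∈ Set.Icc (0:ℝ) 1, ‖h (k / d + x)‖ ≤ u k := by
  obtain ⟨C₀, hC₀, h₀⟩ := h.decay 0 0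
  obtain ⟨C₂, hC₂, h₂⟩ := h.decay 2 0
  simp only [pow_zero, one_mul, norm_iteratedFDeriv_zero, Real.norm_eq_abs, sq_abs] at h₀ h₂
  refine ⟨fun k => (if k = 0 then C₀ else 0) + 2 * d ^ 2 * (C₀ + C₂) * (1 / (k : ℝ) ^ 2), ?_, ?_⟩
  · refine Summable.add (summable_of_hasFiniteSupport ?_)
      ((Real.summable_one_div_int_pow.2 one_lt_two).mul_left _)
    exact (Set.finite_singleton (0 : ℤ)).subset fun k hk => by
      by_contra hk0
      exact hk (if_neg hk0)
  · intro k x hx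
    rcases eq_or_ne k 0 with rfl | hk
    · simpa using h₀ _
    · simp only [if_neg hk]
      rw [zero_add, mul_one_div, le_div_iff₀ (by positivity)]
      have hd' : (d : ℝ) ≠ 0 := Int.cast_ne_zero.2 hd
      set y : ℝ := k / d + x with hy
      have hky : (k : ℝ) = d * (y - x) := by rw [hy]; field_simp; ring
      have hyx : (y - x) ^ 2 ≤ 2 * (1 + y ^ 2) := by nlinarith [hx.1, hx.2, sq_nonneg (y + x)]
      calc ‖h y‖ * (k : ℝ) ^ 2 = d ^ 2 * (‖h y‖ * (y - x) ^ 2) := by rw [hky]; ring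
        _ ≤ d ^ 2 * (‖h y‖ * (2 * (1 + y ^ 2))) := by gcongr
        _ = 2 * d ^ 2 * (‖h y‖ + y ^ 2 * ‖h y‖) := by ring
        _ ≤ 2 * d ^ 2 * (C₀ + C₂) := by gcongr; exacts [h₀ y, h₂ y]

lemma sum_range_unitExp_div {d : ℤ} (hd : d ≠ 0) (z : ℤ) :
    ∑ j ∈ Finset.range d.natAbs, unitExp (z * j / d) = if d ∣ z then (d.natAbs : ℂ) else 0 := by
  have hd' : (d : ℝ) ≠ 0 := Int.cast_ne_zero.2 hd
  have hpow (j : ℕ) : unitExp (z * j / d) = unitExp (z / d) ^ j := by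
    rw [← unitExp_nat_mul]; ring_nf
  have hone : unitExp (z / d) = 1 ↔ d ∣ z := by
    rw [unitExp_eq_one_iff]
    refine exists_congr fun n => ?_
    rw [div_eq_iff hd', mul_comm]
    exact_mod_cast Iff.rfl
  simp only [hpow]
  split_ifs with hz
  · simp [hone.2 hz]
  · have hne : unitExp (z / d) ≠ 1 := mt hone.1 hz
    have hn : unitExp (z / d) ^ d.natAbs = 1 := by
      rw [← hpow, unitExp_eq_one_iff]
      rcases Int.natAbs_eq d with h | h
      · refine ⟨z, ?_⟩
        have : ((d.natAbs : ℤ) : ℝ) = d := by exact_mod_cast h.symm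
        rw [Int.cast_natCast] at this
        rw [this]; field_simp
      · refine ⟨-z, ?_⟩
        have : ((d.natAbs : ℤ) : ℝ) = -d := by exact_mod_cast (by lia : (d.natAbs : ℤ) = -d)
        rw [Int.cast_natCast] at this
        rw [this]; push_cast; field_simp
    rw [geom_sum_eq hne, hn, sub_self, zero_div]

/-- The discrete Fourier transform of `γ` modulo `d`, evaluated at an integer. -/
noncomputable def zmodFourier (d : ℤ) (γ : ZMod d.natAbs → ℂ) (k : ℤ) : ℂ :=
  ∑' q : ZMod d.natAbs, γ q * unitExp (-(q.val * k / d))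

lemma zmodFourier_add_mul {d : ℤ} (hd : d ≠ 0) (γ : ZMod d.natAbs → ℂ) (j r : ℤ) :
    zmodFourier d γ (j + d * r) = zmodFourier d γ j := by
  have hd' : (d : ℝ) ≠ 0 := Int.cast_ne_zero.2 hd
  refine tsum_congr fun q => ?_
  rw [← unitExp_add_intCast _ (q.val * r)]
  congr 2
  push_cast
  field_simp
  ring

lemma sum_range_zmodFourier_mul_conj {d : ℤ} (hd : d ≠ 0) (γ : ZMod d.natAbs → ℂ) (l m : ℤ) :
    ∑ j ∈ Finset.range d.natAbs,
        zmodFourier d γ j * conj (zmodFourier d γ (j - l)) * unitExp (m * j / d) =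
      d.natAbs * unitExp (m * l / d) *
        ∑' q : ZMod d.natAbs, γ q * conj (γ (q - m)) * unitExp (-(q.val * l / d)) := by
  have hd' : (d : ℝ) ≠ 0 := Int.cast_ne_zero.2 hd
  have : NeZero d.natAbs := ⟨Int.natAbs_ne_zero.2 hd⟩
  simp only [zmodFourier, tsum_fintype, map_sum, map_mul, conj_unitExp, neg_neg,
    Finset.sum_mul]
  rw [Finset.sum_comm, Finset.mul_sum]
  refine Finset.sum_congr rfl fun q _ => ?_
  simp only [Finset.mul_sum, Finset.sum_mul]
  rw [Finset.sum_comm]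
  have hterm (q' : ZMod d.natAbs) :
      ∑ j ∈ Finset.range d.natAbs, γ q * unitExp (-(q.val * (j : ℤ) / d)) *
        (conj (γ q') * unitExp (q'.val * ((j - l : ℤ) : ℝ) / d)) * unitExp (m * j / d) =
      if q' = q - m then d.natAbs * unitExp (m * l / d) *
        (γ q * conj (γ (q - m)) * unitExp (-(q.val * l / d))) else 0 := by
    have hdvd : d ∣ (q'.val - q.val + m : ℤ) ↔ q' = q - m := by
      rw [← Int.natAbs_dvd, ← ZMod.intCast_zmod_eq_zero_iff_dvd]
      push_cast
      rw [ZMod.natCast_zmod_val, ZMod.natCast_zmod_val, eq_sub_iff_add_eq]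
      constructor <;> intro h <;> linear_combination h
    have hj (j : ℕ) : γ q * unitExp (-(q.val * (j : ℤ) / d)) *
        (conj (γ q') * unitExp (q'.val * ((j - l : ℤ) : ℝ) / d)) * unitExp (m * j / d) =
        γ q * conj (γ q') * unitExp (-(q'.val * l / d)) *
          unitExp ((q'.val - q.val + m : ℤ) * j / d) := by
      have : unitExp (-(q.val * (j : ℤ) / d)) * unitExp (q'.val * ((j - l : ℤ) : ℝ) / d) *
          unitExp (m * j / d) = unitExp (-(q'.val * l / d)) *
          unitExp ((q'.val - q.val + m : ℤ) * j / d) := by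
        simp only [← unitExp_add]
        congr 1
        push_cast
        ring
      linear_combination γ q * conj (γ q') * this
    rw [Finset.sum_congr rfl fun j _ => hj j, ← Finset.mul_sum, sum_range_unitExp_div hd]
    simp only [hdvd]
    split_ifs with hq
    · obtain ⟨r, hr⟩ := hdvd.2 hq
      have hr' : (q'.val : ℝ) = d * r + q.val - m := by
        have : (q'.val : ℝ) - q.val + m = d * r := by exact_mod_cast hr
        linarith
      have : unitExp (-(q'.val * l / d)) = unitExp (m * l / d) * unitExp (-(q.val * l / d)) := by
        rw [← unitExp_add, hr', ← unitExp_add_intCast _ (r * l)]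
        congr 1
        push_cast
        field_simp
        ring
      rw [this, hq]
      ring
    · simp
  simp only [hterm, Finset.sum_ite_eq', Finset.mem_univ, if_true]

lemma norm_zmodFourier_le {d : ℤ} (hd : d ≠ 0) (γ : ZMod d.natAbs → ℂ) (k : ℤ) :
    ‖zmodFourier d γ k‖ ≤ ∑' q, ‖γ q‖ := by
  have : NeZero d.natAbs := ⟨Int.natAbs_ne_zero.2 hd⟩
  rw [zmodFourier, tsum_fintype, tsum_fintype]
  exact (norm_sum_le _ _).trans_eq (by simp)

lemma tsum_mul_BWZ {d : ℤ} (hd : d ≠ 0) (h : SchwartzMap ℝ ℂ) (γ : ZMod d.natAbs → ℂ)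
    {a : ℝ} (ha : a ∈ Set.Icc (0:ℝ) 1) (b c : ℝ) :
    ∑' q : ZMod d.natAbs, γ q * BWZ d (q.val : ℤ) h (a, b, c) =
      ((Real.sqrt |(d : ℝ)| / d : ℝ) : ℂ) * unitExp (d * c) *
        ∑' k : ℤ, zmodFourier d γ k * h (k / d + a) * unitExp (k * b) := by
  have : NeZero d.natAbs := ⟨Int.natAbs_ne_zero.2 hd⟩
  obtain ⟨u, hu, hbound⟩ := h.exists_summable_bound hd
  have hBWZ (q : ZMod d.natAbs) : γ q * BWZ d (q.val : ℤ) h (a, b, c) =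
      ((Real.sqrt |(d : ℝ)| / d : ℝ) : ℂ) * unitExp (d * c) *
        ∑' k : ℤ, γ q * unitExp (-(q.val * k / d)) * h (k / d + a) * unitExp (k * b) := by
    rw [BWZ, ← mul_assoc, ← tsum_mul_left, ← tsum_mul_left]
    refine tsum_congr fun k => ?_
    have h1 : Complex.exp (-(2 * (π : ℂ) * Complex.I * ((q.val : ℤ) : ℂ) * (k : ℂ)) / (d : ℂ)) =
        unitExp (-(q.val * k / d)) := by
      rw [unitExp]; push_cast; ring_nf
    have h2 : Complex.exp (2 * (π : ℂ) * Complex.I * ((d : ℂ) * (c : ℂ) + (k : ℂ) * (b : ℂ))) =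
        unitExp (d * c) * unitExp (k * b) := by
      rw [← unitExp_add, unitExp]; push_cast; ring_nf
    simp only [h1, h2]
    ring
  simp only [hBWZ]
  rw [tsum_mul_left, tsum_fintype, ← Summable.tsum_finsetSum fun q _ => ?_]
  · congr 1
    refine tsum_congr fun k => ?_
    rw [zmodFourier, tsum_fintype, Finset.sum_mul, Finset.sum_mul]
  · refine Summable.of_norm_bounded (hu.mul_left ‖γ q‖) fun k => ?_
    simpa using mul_le_mul_of_nonneg_left (hbound k a ha) (norm_nonneg (γ q))

lemma norm_sqrt_abs_div_sq {d : ℤ} (hd : d ≠ 0) :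
    ‖((Real.sqrt |(d : ℝ)| / d : ℝ) : ℂ)‖ ^ 2 = (d.natAbs : ℝ)⁻¹ := by
  have hd' : |(d : ℝ)| ≠ 0 := abs_ne_zero.2 (Int.cast_ne_zero.2 hd)
  rw [Complex.norm_real, Real.norm_eq_abs, sq_abs, div_pow, Real.sq_sqrt (abs_nonneg _),
    Nat.cast_natAbs, Int.cast_abs, ← sq_abs (d : ℝ)]
  field_simp

/-- **L⁴ identity for superpositions of BWZ transforms.**
Here `q ∈ ℤ/λℤ` is represented by its canonical representative `q.val`
(recall `BWZ_{λ,q}` depends only on `q` mod `λ`). -/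
theorem BWZ_L4_identity (lam : ℤ) (hlam : lam ≠ 0) (h : SchwartzMap ℝ ℂ)
    (γ : ZMod lam.natAbs → ℂ) :
    (∫ a in Set.Icc (0:ℝ) 1, ∫ b in Set.Icc (0:ℝ) 1, ∫ c in Set.Icc (0:ℝ) 1,
        ‖∑' q : ZMod lam.natAbs, γ q * BWZ lam (q.val : ℤ) (⇑h) (a, b, c)‖ ^ 4)
      = ∑' ab : ℤ × ℤ,
          ‖(∑' q : ZMod lam.natAbs,
                γ q * conj (γ (q - (ab.2 : ZMod lam.natAbs))) *
                  Complex.exp (2 * (π : ℂ) * Complex.I * (q.val : ℂ) * (ab.1 : ℂ) / (lam : ℂ))) *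
              ∫ u : ℝ, h u * conj (Complex.exp (2 * (π : ℂ) * Complex.I * (u : ℂ) * (ab.2 : ℂ)) *
                h (u + (ab.1 : ℝ) / (lam : ℝ)))‖ ^ 2 := by
  have hn : (lam.natAbs : ℂ) ≠ 0 := Nat.cast_ne_zero.2 (Int.natAbs_ne_zero.2 hlam)
  obtain ⟨u, hu, hbound⟩ := h.exists_summable_bound hlam
  obtain ⟨C, hC, hhC⟩ := h.decay 0 0
  simp only [pow_zero, one_mul, norm_iteratedFDeriv_zero] at hhC
  set B : ℝ := ∑' q, ‖γ q‖
  have hB : 0 ≤ B := tsum_nonneg fun _ => norm_nonneg _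
  set c : ℝ → ℤ → ℂ := fun a k => zmodFourier lam γ k * h (k / lam + a) with hc
  have hcs (a : ℝ) (ha : a ∈ Set.Icc (0:ℝ) 1) : Summable fun k => ‖c a k‖ := by
    refine Summable.of_nonneg_of_le (fun _ => norm_nonneg _) (fun k => ?_) (hu.mul_left B)
    rw [norm_mul]
    exact mul_le_mul (norm_zmodFourier_le hlam γ k) (hbound k a ha) (norm_nonneg _) hB
  set f : ℝ → ℝ → ℂ := fun a b =>
    (lam.natAbs : ℂ)⁻¹ * ((‖∑' k, c a k * unitExp (k * b)‖ ^ 2 : ℝ) : ℂ) with hf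
  have hleft (a : ℝ) (ha : a ∈ Set.Icc (0:ℝ) 1) (b x : ℝ) :
      ‖∑' q : ZMod lam.natAbs, γ q * BWZ lam (q.val : ℤ) (⇑h) (a, b, x)‖ ^ 4 = ‖f a b‖ ^ 2 := by
    rw [tsum_mul_BWZ hlam h γ ha, hf, show (4 : ℕ) = 2 * 2 from rfl, pow_mul]
    simp only [norm_mul, norm_unitExp, mul_one, mul_pow, norm_sqrt_abs_div_sq hlam, hc]
    simp
  set A : ℤ → ℤ → ℂ := fun l k => zmodFourier lam γ k * conj (zmodFourier lam γ (k - l)) with hA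
  set H : ℤ → ℝ → ℂ := fun l x => h x * conj (h (x - l / lam)) with hH
  have hHc (l : ℤ) : Continuous (H l) := by
    have := h.continuous
    fun_prop
  have hHi (l : ℤ) : Integrable (H l) := by
    refine h.integrable.mul_bdd (c := C) ?_ (ae_of_all _ fun x => by simpa using hhC _)
    have := h.continuous
    exact Continuous.aestronglyMeasurable (by fun_prop)
  have hAH (l k : ℤ) (x : ℝ) (hx : x ∈ Set.Icc (0:ℝ) 1) :
      ‖A l k * H l (k / lam + x)‖ ≤ B * B * C * u k := by
    have h1 := norm_zmodFourier_le hlam γ k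
    have h2 := norm_zmodFourier_le hlam γ (k - l)
    simp only [hA, hH, norm_mul, RCLike.norm_conj]
    calc _ ≤ B * B * (u k * C) := by
          gcongr
          exacts [(norm_nonneg _).trans (hbound k x hx), hbound k x hx, hhC _]
      _ = _ := by ring
  have hcoeff (l : ℤ) (a : ℝ) (ha : a ∈ Set.Icc (0:ℝ) 1) :
      ∫ b in (0:ℝ)..1, unitExp (-(l * b)) * f a b =
        (lam.natAbs : ℂ)⁻¹ * ∑' k : ℤ, A l k * H l (k / lam + a) := by
    simp only [hf, mul_left_comm _ (lam.natAbs : ℂ)⁻¹]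
    rw [intervalIntegral.integral_const_mul, integral_unitExp_mul_sq_norm_tsum (hcs a ha)]
    congr 1
    refine tsum_congr fun k => ?_
    simp only [hc, hA, hH, map_mul]
    rw [show ((k - l : ℤ) : ℝ) / lam + a = k / lam + a - l / lam by push_cast; ring]
    ring
  calc _ = ∫ a in Set.Icc (0:ℝ) 1, ∫ b in Set.Icc (0:ℝ) 1, ‖f a b‖ ^ 2 := by
        refine setIntegral_congr_fun measurableSet_Icc fun a ha => ?_
        simp only [hleft a ha]
        simp
    _ = ∑' p : ℤ × ℤ, ‖∫ a in (0:ℝ)..1, unitExp (-(p.2 * a)) *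
          ((lam.natAbs : ℂ)⁻¹ * ∑' k : ℤ, A p.1 k * H p.1 (k / lam + a))‖ ^ 2 := by
        refine integral_integral_sq_norm_eq_tsum
          (ψ := fun l a => (lam.natAbs : ℂ)⁻¹ * ∑' k : ℤ, A l k * H l (k / lam + a))
          (fun a ha => ?_) hcoeff fun l => ?_
        · have := continuous_tsum_mul_unitExp (hcs a ha)
          exact Continuous.continuousOn (by fun_prop)
        · refine continuousOn_const.mul (continuousOn_tsum (fun k => ?_)
            (hu.mul_left (B * B * C)) fun k x hx => hAH l k x hx)
          have := hHc l
          exact Continuous.continuousOn (by fun_prop)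
    _ = _ := by
        rw [← ((Equiv.neg ℤ).prodCongr (Equiv.refl ℤ)).tsum_eq]
        refine tsum_congr fun ⟨l, m⟩ => ?_
        obtain ⟨l, rfl⟩ : ∃ l' : ℤ, l = -l' := ⟨-l, (neg_neg l).symm⟩
        simp only [mul_left_comm _ (lam.natAbs : ℂ)⁻¹, Equiv.prodCongr_apply, Prod.map_apply,
          Equiv.neg_apply, Equiv.refl_apply, neg_neg]
        have hAper (j r : ℤ) : A l (j + lam * r) = A l j := by
          simp only [hA, zmodFourier_add_mul hlam]
          rw [show j + lam * r - l = j - l + lam * r by ring, zmodFourier_add_mul hlam]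
        rw [intervalIntegral.integral_const_mul, integral_unitExp_mul_tsum_comp_add hlam hAper
          (hHc l) (hHi l) (hu.mul_left (B * B * C)) (hAH l), hA]
        have hsum := sum_range_zmodFourier_mul_conj hlam γ l m
        rw [hsum, mul_assoc (lam.natAbs : ℂ), mul_assoc (lam.natAbs : ℂ), inv_mul_cancel_left₀ hn,
          mul_assoc, norm_mul, norm_unitExp, one_mul]
        congr 3
        · refine tsum_congr fun q => ?_
          rw [unitExp]
          push_cast
          ring_nf
        · refine integral_congr_ae (ae_of_all _ fun x => ?_)
          have h1 : unitExp (-(m * x)) =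
              conj (Complex.exp (2 * (π : ℂ) * Complex.I * (x : ℂ) * (m : ℂ))) := by
            rw [← conj_unitExp, unitExp]
            push_cast
            ring_nf
          simp only [hH, h1, map_mul]
          rw [show x - (l : ℝ) / lam = x + ((-l : ℤ) : ℝ) / lam by push_cast; ring]
          ring
end
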